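/- Let h be a harmonic function on an open set Ω ⊆ ℝⁿ (n ≥ 3) containing a, and set φ(x) = h(x)/|x−a|^{n−2+s} for a constant s ≥ 0, defined on Ω \ {a}. Then for all sufficiently small r > 0, (1/(σ_{n-1} r^{n-1})) ∫_{∂B(a,r)} ∂φ/∂ν dσ = −(n−2+s) h(a) / r^{n-1+s}. -/

import Mathlib

open MeasureTheory Metric Set Filter
open scoped Topology RealInnerProductSpace

noncomputable section

/-- Euclidean n-space. -/
abbrev Euc (n : ℕ) := EuclideanSpace ℝ (Fin n)

/-- The surface measure on the unit sphere of `ℝⁿ`. -/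
def unitSphereM (n : ℕ) : Measure (sphere (0 : Euc n) 1) :=
  (volume : Measure (Euc n)).toSphere

/-- `σ_{n-1}`, the total surface area of the unit sphere in `ℝⁿ`. -/
def sphereArea (n : ℕ) : ℝ := (unitSphereM n Set.univ).toReal

/-- `ω_n`, the volume of the unit ball in `ℝⁿ`. -/
def ballVol (n : ℕ) : ℝ := (volume (ball (0 : Euc n) 1)).toReal

/-- The spherical mean `(1/(σ_{n-1} t^{n-1})) ∫_{∂B(a,t)} φ dσ`, expressed by
rescaling the sphere integral to the unit sphere. -/
def sphMean {n : ℕ} (φ : Euc n → ℝ) (a : Euc n) (t : ℝ) : ℝ :=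
  (sphereArea n)⁻¹ * ∫ ω : sphere (0 : Euc n) 1, φ (a + t • (ω : Euc n)) ∂(unitSphereM n)

/-- The solid mean `(1/(ω_n r^n)) ∫_{B(a,r)} φ dV`. -/
def solidMean {n : ℕ} (φ : Euc n → ℝ) (a : Euc n) (r : ℝ) : ℝ :=
  (ballVol n * r ^ n)⁻¹ * ∫ x in ball a r, φ x

/-- The Laplacian `Δφ = Σ ∂²φ/∂xᵢ²`. -/
def lap {n : ℕ} (φ : Euc n → ℝ) (x : Euc n) : ℝ :=
  ∑ i : Fin n,
    fderiv ℝ (fun y => fderiv ℝ φ y (EuclideanSpace.single i 1)) x (EuclideanSpace.single i 1)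

/-- The divergence of a vector field on `ℝⁿ`. -/
def divg {n : ℕ} (F : Euc n → Euc n) (x : Euc n) : ℝ :=
  ∑ i : Fin n,
    ⟪fderiv ℝ F x (EuclideanSpace.single i 1), (EuclideanSpace.single i 1 : Euc n)⟫

theorem integral_eq_integral_Ioi_integral_sphere {E : Type*} [NormedAddCommGroup E]
    [NormedSpace ℝ E] [FiniteDimensional ℝ E] [Nontrivial E] [MeasurableSpace E] [BorelSpace E]
    (μ : Measure E) [μ.IsAddHaarMeasure] {f : E → ℝ} (hf : Integrable f μ) :
    ∫ x, f x ∂μ = ∫ t in Ioi (0 : ℝ),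
      t ^ (Module.finrank ℝ E - 1) * ∫ ω : sphere (0 : E) 1, f (t • (ω : E)) ∂μ.toSphere := by
  set d := Module.finrank ℝ E - 1
  let G : sphere (0 : E) 1 × Ioi (0 : ℝ) → ℝ := fun p => f (p.2.1 • (p.1 : E))
  have hmp := μ.measurePreserving_homeomorphUnitSphereProd
  have hemb := (homeomorphUnitSphereProd E).measurableEmbedding
  have hcomp : G ∘ homeomorphUnitSphereProd E = fun x : ({(0)}ᶜ : Set E) => f x := by
    funext x
    have hx : ‖(x : E)‖ ≠ 0 := norm_ne_zero_iff.2 x.2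
    simp [G, smul_smul, hx]
  have hint : Integrable G (μ.toSphere.prod (Measure.volumeIoiPow d)) := by
    rw [← hmp.integrable_comp_emb hemb, hcomp]
    have hm : MeasurableSet ({(0)}ᶜ : Set E) := (measurableSet_singleton _).compl
    refine (MeasurableEmbedding.subtype_coe hm).integrable_map_iff.1 ?_
    rw [map_comap_subtype_coe hm]
    exact hf.integrableOn
  calc
    ∫ x, f x ∂μ = ∫ x : ({(0)}ᶜ : Set E), f x ∂(μ.comap (↑)) := by
      rw [integral_subtype_comap (measurableSet_singleton _).compl f,
        restrict_compl_singleton]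
    _ = ∫ p, G p ∂μ.toSphere.prod (.volumeIoiPow d) := by
      rw [← hmp.integral_comp hemb, ← hcomp]
      rfl
    _ = ∫ t, ∫ ω, G (ω, t) ∂μ.toSphere ∂.volumeIoiPow d := integral_prod_symm _ hint
    _ = _ := by
      simp only [Measure.volumeIoiPow, ENNReal.ofReal, G]
      rw [integral_withDensity_eq_integral_smul,
        integral_subtype_comap measurableSet_Ioi fun a ↦
          Real.toNNReal (a ^ d) • ∫ ω : sphere (0 : E) 1, f (a • (ω : E)) ∂μ.toSphere,
        setIntegral_congr_fun measurableSet_Ioi fun x hx ↦ ?_]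
      · simp only [NNReal.smul_def]
        rw [Real.coe_toNNReal _ (pow_nonneg hx.out.le _), smul_eq_mul]
      · exact (measurable_subtype_coe.pow_const _).real_toNNReal

theorem integral_fderiv_apply_eq_zero {E : Type*} [NormedAddCommGroup E] [NormedSpace ℝ E]
    [FiniteDimensional ℝ E] [MeasurableSpace E] [BorelSpace E] (μ : Measure E)
    [μ.IsAddHaarMeasure] {f : E → ℝ} (hf : ContDiff ℝ 1 f) (hc : HasCompactSupport f) (v : E) :
    Integrable (fun x => fderiv ℝ f x v) μ ∧ ∫ x, fderiv ℝ f x v ∂μ = 0 := by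
  have hi : Integrable (fun x => fderiv ℝ f x v) μ :=
    ((hf.continuous_fderiv one_ne_zero).clm_apply continuous_const).integrable_of_hasCompactSupport
      (hc.fderiv_apply (𝕜 := ℝ) v)
  refine ⟨hi, ?_⟩
  have := integral_mul_fderiv_eq_neg_fderiv_mul_of_integrable (𝕜 := ℝ) (μ := μ)
    (f := fun _ : E => (1 : ℝ)) (g := f) (v := v) (by simp) (by simpa using hi)
    (by simpa using hf.continuous.integrable_of_hasCompactSupport hc)
    (fun _ _ => by fun_prop) (fun x _ => hf.differentiable one_ne_zero x)
  simpa using this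

theorem exists_antideriv_of_tsupport_subset_Ioo {R : ℝ} {γ : ℝ → ℝ} (hγ : Continuous γ)
    (hc : HasCompactSupport γ) (hs : tsupport γ ⊆ Ioo 0 R) :
    ∃ Γ : ℝ → ℝ, (∀ t, HasDerivAt Γ (γ t) t) ∧
      (∃ c > 0, ∀ t < c, Γ t = Γ 0) ∧ ∃ d < R, ∀ t > d, Γ t = 0 := by
  obtain ⟨c, d, hc0, hdR, hcd⟩ : ∃ c d : ℝ, 0 < c ∧ d < R ∧ tsupport γ ⊆ Icc c d := by
    rcases (tsupport γ).eq_empty_or_nonempty with h | h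
    · exact ⟨1, R - 1, one_pos, by linarith, by simp [h]⟩
    · obtain ⟨c, hcm⟩ := hc.exists_isLeast h
      obtain ⟨d, hdm⟩ := hc.exists_isGreatest h
      exact ⟨c, d, (hs hcm.1).1, (hs hdm.1).2, fun x hx => ⟨hcm.2 hx, hdm.2 hx⟩⟩
  have hz : ∀ t ∉ Icc c d, γ t = 0 := fun t ht =>
    image_eq_zero_of_notMem_tsupport fun h => ht (hcd h)
  refine ⟨fun t => ∫ u in R..t, γ u, fun t => ?_, ⟨c, hc0, fun t ht => ?_⟩, d, hdR, fun t ht => ?_⟩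
  · exact intervalIntegral.integral_hasDerivAt_right (hγ.intervalIntegrable _ _)
      hγ.aestronglyMeasurable.stronglyMeasurableAtFilter hγ.continuousAt
  · rw [← sub_eq_zero, intervalIntegral.integral_interval_sub_left (hγ.intervalIntegrable _ _)
      (hγ.intervalIntegrable _ _)]
    refine intervalIntegral.integral_zero_ae (.of_forall fun u hu => hz u fun h => ?_)
    exact absurd h.1 (not_le.2 (hu.2.trans_lt (max_lt hc0 ht)))
  · refine intervalIntegral.integral_zero_ae (.of_forall fun u hu => hz u fun h => ?_)
    exact absurd h.2 (not_le.2 ((lt_min hdR ht).trans hu.1))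

theorem add_smul_sphere_mem_closedBall {E : Type*} [NormedAddCommGroup E] [NormedSpace ℝ E]
    {a : E} {R t : ℝ} (ht : t ∈ Icc (-R) R) (ω : sphere (0 : E) 1) :
    a + t • (ω : E) ∈ closedBall a R := by
  simpa [norm_smul, abs_le] using ht

theorem continuousOn_integral_sphere {n : ℕ} {a : Euc n} {R : ℝ} {h : Euc n → ℝ}
    (hh : ∀ x ∈ closedBall a R, ContDiffAt ℝ 1 h x) :
    ContinuousOn (fun t : ℝ => ∫ ω : sphere (0 : Euc n) 1,
      fderiv ℝ h (a + t • (ω : Euc n)) (ω : Euc n) ∂(unitSphereM n)) (Icc (-R) R) := by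
  have : IsFiniteMeasure (unitSphereM n) := by unfold unitSphereM; infer_instance
  have hd : ContinuousOn (fderiv ℝ h) (closedBall a R) := fun x hx =>
    ((hh x hx).fderiv_right (m := 0) le_rfl).continuousAt.continuousWithinAt
  obtain ⟨C, hC⟩ := (isCompact_closedBall a R).exists_bound_of_continuousOn hd
  refine continuousOn_of_dominated (bound := fun _ => C) (fun t ht => ?_) (fun t ht => ?_)
    (integrable_const C) (.of_forall fun ω => ?_)
  · refine Continuous.aestronglyMeasurable (.clm_apply ?_ continuous_subtype_val)
    exact hd.comp_continuous (by fun_prop) fun ω => add_smul_sphere_mem_closedBall ht ω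
  · refine .of_forall fun ω => ?_
    have := (fderiv ℝ h (a + t • (ω : Euc n))).le_opNorm ω
    rw [norm_eq_of_mem_sphere, mul_one] at this
    exact this.trans (hC _ (add_smul_sphere_mem_closedBall ht ω))
  · refine ContinuousOn.clm_apply ?_ continuousOn_const
    exact hd.comp (by fun_prop) fun t ht => add_smul_sphere_mem_closedBall ht ω

theorem hasDerivAt_integral_sphere {n : ℕ} {a : Euc n} {R : ℝ} {h : Euc n → ℝ}
    (hh : ∀ x ∈ closedBall a R, ContDiffAt ℝ 1 h x) {t : ℝ} (ht : t ∈ Ioo (-R) R) :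
    HasDerivAt (fun t : ℝ => ∫ ω : sphere (0 : Euc n) 1, h (a + t • (ω : Euc n)) ∂(unitSphereM n))
      (∫ ω : sphere (0 : Euc n) 1,
        fderiv ℝ h (a + t • (ω : Euc n)) (ω : Euc n) ∂(unitSphereM n)) t := by
  have : IsFiniteMeasure (unitSphereM n) := by unfold unitSphereM; infer_instance
  have hd : ContinuousOn (fderiv ℝ h) (closedBall a R) := fun x hx =>
    ((hh x hx).fderiv_right (m := 0) le_rfl).continuousAt.continuousWithinAt
  have hcont : ContinuousOn h (closedBall a R) := fun x hx =>
    (hh x hx).continuousAt.continuousWithinAt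
  obtain ⟨C, hC⟩ := (isCompact_closedBall a R).exists_bound_of_continuousOn hd
  have hhc : ∀ t ∈ Ioo (-R) R, Continuous fun ω : sphere (0 : Euc n) 1 => h (a + t • (ω : Euc n)) :=
    fun t ht => hcont.comp_continuous (by fun_prop) fun ω =>
      add_smul_sphere_mem_closedBall (Ioo_subset_Icc_self ht) ω
  have hmem : Ioo (-R) R ∈ 𝓝 t := isOpen_Ioo.mem_nhds ht
  refine (hasDerivAt_integral_of_dominated_loc_of_deriv_le (bound := fun _ => C)
    (F := fun t (ω : sphere (0 : Euc n) 1) => h (a + t • (ω : Euc n)))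
    (F' := fun t (ω : sphere (0 : Euc n) 1) => fderiv ℝ h (a + t • (ω : Euc n)) (ω : Euc n))
    hmem ?_ ?_ ?_ ?_ (integrable_const C) ?_).2
  · filter_upwards [hmem] with t ht using (hhc t ht).aestronglyMeasurable
  · exact (hhc t ht).integrable_of_hasCompactSupport (HasCompactSupport.of_compactSpace _)
  · refine Continuous.aestronglyMeasurable (.clm_apply ?_ continuous_subtype_val)
    exact hd.comp_continuous (by fun_prop) fun ω =>
      add_smul_sphere_mem_closedBall (Ioo_subset_Icc_self ht) ω
  · refine .of_forall fun ω t ht => ?_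
    have := (fderiv ℝ h (a + t • (ω : Euc n))).le_opNorm ω
    rw [norm_eq_of_mem_sphere, mul_one] at this
    exact this.trans (hC _ (add_smul_sphere_mem_closedBall (Ioo_subset_Icc_self ht) ω))
  · refine .of_forall fun ω t ht => ?_
    have h1 := ((hh _ (add_smul_sphere_mem_closedBall (Ioo_subset_Icc_self ht) ω)).differentiableAt
      one_ne_zero).hasFDerivAt
    have h2 : HasDerivAt (fun t : ℝ => a + t • (ω : Euc n)) (ω : Euc n) t := by
      simpa using ((hasDerivAt_id t).smul_const (ω : Euc n)).const_add a
    exact h1.comp_hasDerivAt t h2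

theorem hasFDerivAt_norm_of_ne_zero {E : Type*} [NormedAddCommGroup E] [InnerProductSpace ℝ E]
    {x : E} (hx : x ≠ 0) : HasFDerivAt (‖·‖ : E → ℝ) (‖x‖⁻¹ • innerSL ℝ x) x := by
  have hx' : ‖x‖ ≠ 0 := norm_ne_zero_iff.2 hx
  have h1 := (hasStrictFDerivAt_norm_sq x).hasFDerivAt.sqrt (pow_ne_zero 2 hx')
  simp only [Real.sqrt_sq (norm_nonneg _)] at h1
  convert h1 using 1
  ext v
  simp
  field_simp

theorem contDiff_radial {E : Type*} [NormedAddCommGroup E] [InnerProductSpace ℝ E]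
    (a : E) {Γ γ : ℝ → ℝ} (hΓ : ∀ t, HasDerivAt Γ (γ t) t) (hγ : Continuous γ)
    {c : ℝ} (hc : 0 < c) (hconst : ∀ t < c, Γ t = Γ 0) :
    ContDiff ℝ 1 (fun x => Γ ‖x - a‖) ∧
      ∀ x v, fderiv ℝ (fun x => Γ ‖x - a‖) x v = γ ‖x - a‖ * (‖x - a‖⁻¹ * ⟪x - a, v⟫) := by
  have hΓ1 : ContDiff ℝ 1 Γ := by
    rw [contDiff_one_iff_deriv, funext fun t => (hΓ t).deriv]
    exact ⟨fun t => (hΓ t).differentiableAt, hγ⟩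
  have hev : (fun x => Γ ‖x - a‖) =ᶠ[𝓝 a] fun _ => Γ 0 := by
    filter_upwards [ball_mem_nhds a hc] with x hx using hconst _ (by rwa [← dist_eq_norm])
  refine ⟨contDiff_iff_contDiffAt.2 fun x => ?_, fun x v => ?_⟩
  · rcases eq_or_ne x a with rfl | hx
    · exact contDiffAt_const.congr_of_eventuallyEq hev
    · exact hΓ1.contDiffAt.comp x
        ((contDiffAt_id.sub contDiffAt_const).norm ℝ (sub_ne_zero.2 hx))
  · rcases eq_or_ne x a with rfl | hx
    · simp [hev.fderiv_eq]
    · have h1 := (hasFDerivAt_norm_of_ne_zero (sub_ne_zero.2 hx)).comp x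
        ((hasFDerivAt_id x).sub_const a)
      have h2 := (hΓ ‖x - a‖).comp_hasFDerivAt x h1
      have h3 : fderiv ℝ (fun x => Γ ‖x - a‖) x = _ := h2.fderiv
      rw [h3]
      simp [inner_sub_left]

theorem integral_radial_mul_fderiv_eq_zero {n : ℕ} {a : Euc n} {R : ℝ} {h : Euc n → ℝ}
    (hh : ∀ x ∈ closedBall a R, ContDiffAt ℝ 2 h x) (hharm : ∀ x ∈ closedBall a R, lap h x = 0)
    {γ : ℝ → ℝ} (hγ : Continuous γ) (hc : HasCompactSupport γ) (hs : tsupport γ ⊆ Ioo 0 R) :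
    Integrable (fun x => γ ‖x - a‖ * (‖x - a‖⁻¹ * fderiv ℝ h x (x - a))) ∧
      ∫ x, γ ‖x - a‖ * (‖x - a‖⁻¹ * fderiv ℝ h x (x - a)) = 0 := by
  obtain ⟨Γ, hΓ, ⟨c, hc0, hΓc⟩, d, hdR, hΓd⟩ := exists_antideriv_of_tsupport_subset_Ioo hγ hc hs
  obtain ⟨hψ, hψ'⟩ := contDiff_radial a hΓ hγ hc0 hΓc
  set ψ : Euc n → ℝ := fun x => Γ ‖x - a‖
  let e : Fin n → Euc n := fun i => EuclideanSpace.single i 1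
  let V : Fin n → Euc n → ℝ := fun i x => ψ x * fderiv ℝ h x (e i)
  have hout : ∀ x ∉ closedBall a R, ∀ i, V i =ᶠ[𝓝 x] fun _ => 0 := fun x hx i => by
    have : {x : Euc n | d < ‖x - a‖} ∈ 𝓝 x := by
      refine (isOpen_lt continuous_const (by fun_prop)).mem_nhds ?_
      rw [mem_closedBall, dist_eq_norm, not_le] at hx
      exact hdR.trans hx
    filter_upwards [this] with y hy
    simp [V, ψ, hΓd _ hy]
  have hdh : ∀ x ∈ closedBall a R, ∀ i, ContDiffAt ℝ 1 (fun x => fderiv ℝ h x (e i)) x :=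
    fun x hx i => ((hh x hx).fderiv_right (m := 1) (by norm_num)).clm_apply contDiffAt_const
  have hV : ∀ i, ContDiff ℝ 1 (V i) := fun i => contDiff_iff_contDiffAt.2 fun x => by
    by_cases hx : x ∈ closedBall a R
    · exact hψ.contDiffAt.mul (hdh x hx i)
    · exact contDiffAt_const.congr_of_eventuallyEq (hout x hx i)
  have hVc : ∀ i, HasCompactSupport (V i) := fun i =>
    HasCompactSupport.intro (isCompact_closedBall a d) fun x hx => by
      rw [mem_closedBall, dist_eq_norm, not_le] at hx
      simp [V, ψ, hΓd _ hx]
  have hsum : (fun x => γ ‖x - a‖ * (‖x - a‖⁻¹ * fderiv ℝ h x (x - a))) =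
      fun x => ∑ i, fderiv ℝ (V i) x (e i) := by
    funext x
    by_cases hx : x ∈ closedBall a R
    · have hexp : ∑ i, (x - a) i • e i = x - a := by
        simpa [e] using (EuclideanSpace.basisFun (Fin n) ℝ).sum_repr (x - a)
      have hV' : ∀ i, fderiv ℝ (V i) x (e i) =
          ψ x * fderiv ℝ (fun y => fderiv ℝ h y (e i)) x (e i) +
          γ ‖x - a‖ * (‖x - a‖⁻¹ * ((x - a) i * fderiv ℝ h x (e i))) := fun i => by
        have := fderiv_fun_mul (hψ.differentiable one_ne_zero x)
          ((hdh x hx i).differentiableAt one_ne_zero)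
        simp only [V]
        rw [this]
        simp only [add_apply, smul_apply, smul_eq_mul,
          hψ']
        simp only [e, EuclideanSpace.inner_single_right]
        simp
        ring
      have hl : ∑ i, fderiv ℝ (fun y => fderiv ℝ h y (e i)) x (e i) = 0 := hharm x hx
      rw [Finset.sum_congr rfl fun i _ => hV' i, Finset.sum_add_distrib, ← Finset.mul_sum, hl,
        ← Finset.mul_sum, ← Finset.mul_sum]
      have hlin : fderiv ℝ h x (x - a) = ∑ i, (x - a) i * fderiv ℝ h x (e i) := by
        conv_lhs => rw [← hexp, map_sum]
        simp only [map_smul, smul_eq_mul]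
      rw [hlin, mul_zero, zero_add]
    · have h0 : γ ‖x - a‖ = 0 := image_eq_zero_of_notMem_tsupport fun hm => hx <| by
        rw [mem_closedBall, dist_eq_norm]
        exact (hs hm).2.le
      simp [h0, (hout x hx _).fderiv_eq]
  rw [hsum]
  have hint := fun i => integral_fderiv_apply_eq_zero volume (hV i) (hVc i) (e i)
  refine ⟨integrable_finsetSum _ fun i _ => (hint i).1, ?_⟩
  rw [integral_finsetSum _ fun i _ => (hint i).1]
  exact Finset.sum_eq_zero fun i _ => (hint i).2

theorem integral_sphere_fderiv_eq_zero {n : ℕ} (hn : 0 < n) {a : Euc n} {R : ℝ} {h : Euc n → ℝ}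
    (hh : ∀ x ∈ closedBall a R, ContDiffAt ℝ 2 h x) (hharm : ∀ x ∈ closedBall a R, lap h x = 0)
    {t : ℝ} (ht : t ∈ Ioo 0 R) :
    ∫ ω : sphere (0 : Euc n) 1,
      fderiv ℝ h (a + t • (ω : Euc n)) (ω : Euc n) ∂(unitSphereM n) = 0 := by
  have : Nonempty (Fin n) := ⟨⟨0, hn⟩⟩
  have : Nontrivial (Euc n) := inferInstance
  set F : ℝ → ℝ := fun t => ∫ ω : sphere (0 : Euc n) 1,
      fderiv ℝ h (a + t • (ω : Euc n)) (ω : Euc n) ∂(unitSphereM n) with hF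
  have hFc : ContinuousOn (fun t => t ^ (n - 1) * F t) (Ioo 0 R) := by
    refine (continuousOn_id.pow _).mul ?_
    refine (continuousOn_integral_sphere fun x hx => (hh x hx).of_le (by norm_num)).mono
      fun t ht => ⟨by linarith [ht.1, ht.2], ht.2.le⟩
  have key : ∀ᵐ t, t ∈ Ioo 0 R → t ^ (n - 1) * F t = 0 := by
    refine isOpen_Ioo.ae_eq_zero_of_integral_contDiff_smul_eq_zero
      (hFc.locallyIntegrableOn measurableSet_Ioo) fun γ hγ hc hs => ?_
    obtain ⟨hi, h0⟩ := integral_radial_mul_fderiv_eq_zero hh hharm hγ.continuous hc hs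
    rw [← integral_add_left_eq_self _ a,
      integral_eq_integral_Ioi_integral_sphere _ (hi.comp_add_left a)] at h0
    rw [← h0, ← setIntegral_eq_integral_of_forall_compl_eq_zero (s := Ioi (0 : ℝ))]
    · refine setIntegral_congr_fun measurableSet_Ioi fun t (ht : 0 < t) => ?_
      simp only [add_sub_cancel_left, norm_smul, norm_eq_of_mem_sphere, mul_one, Real.norm_eq_abs,
        abs_of_pos ht, map_smul, smul_eq_mul, inv_mul_cancel_left₀ ht.ne', finrank_euclideanSpace,
        Fintype.card_fin]
      rw [integral_const_mul, hF]
      simp only [unitSphereM]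
      ring
    · intro t ht
      rw [image_eq_zero_of_notMem_tsupport fun hm => ht (hs hm).1, zero_smul]
  have := Measure.eqOn_open_of_ae_eq (g := fun _ => (0 : ℝ))
    ((ae_restrict_iff' measurableSet_Ioo).2 key) isOpen_Ioo hFc continuousOn_const ht
  exact (mul_eq_zero.1 this).resolve_left (pow_ne_zero _ ht.1.ne')

theorem integral_sphere_eq {n : ℕ} (hn : 0 < n) {a : Euc n} {R : ℝ} {h : Euc n → ℝ}
    (hh : ∀ x ∈ closedBall a R, ContDiffAt ℝ 2 h x) (hharm : ∀ x ∈ closedBall a R, lap h x = 0)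
    {r : ℝ} (hr : r ∈ Ioo 0 R) :
    ∫ ω : sphere (0 : Euc n) 1, h (a + r • (ω : Euc n)) ∂(unitSphereM n) =
      sphereArea n * h a := by
  have hd := fun t (ht : t ∈ Ioo (-R) R) =>
    hasDerivAt_integral_sphere (fun x hx => (hh x hx).of_le (by norm_num)) ht
  have hmem : ∀ t ∈ Icc (0 : ℝ) r, t ∈ Ioo (-R) R := fun t ht =>
    ⟨by linarith [ht.1, hr.1, hr.2], ht.2.trans_lt hr.2⟩
  obtain ⟨c, hc, hslope⟩ := exists_hasDerivAt_eq_slope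
    (fun t => ∫ ω : sphere (0 : Euc n) 1, h (a + t • (ω : Euc n)) ∂(unitSphereM n))
    (fun t => ∫ ω : sphere (0 : Euc n) 1,
      fderiv ℝ h (a + t • (ω : Euc n)) (ω : Euc n) ∂(unitSphereM n)) hr.1
    (fun t ht => (hd t (hmem t ht)).continuousAt.continuousWithinAt)
    (fun t ht => hd t (hmem t (Ioo_subset_Icc_self ht)))
  rw [integral_sphere_fderiv_eq_zero hn hh hharm ⟨hc.1, hc.2.trans hr.2⟩, eq_comm,
    div_eq_zero_iff, sub_eq_zero, sub_zero] at hslope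
  rw [hslope.resolve_right hr.1.ne']
  simp [sphereArea, Measure.real]

theorem fderiv_div_norm_rpow {E : Type*} [NormedAddCommGroup E] [InnerProductSpace ℝ E]
    {a ω : E} {r p : ℝ} (hr : 0 < r) (hω : ‖ω‖ = 1) {h φ : E → ℝ}
    (hh : DifferentiableAt ℝ h (a + r • ω)) (hφ : ∀ x, x ≠ a → φ x = h x / ‖x - a‖ ^ p) :
    fderiv ℝ φ (a + r • ω) ω =
      (r ^ p)⁻¹ * fderiv ℝ h (a + r • ω) ω - p * (r ^ (p + 1))⁻¹ * h (a + r • ω) := by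
  have hne : a + r • ω ≠ a := by
    have : ω ≠ 0 := norm_ne_zero_iff.1 (by simp [hω])
    simp [hr.ne', this]
  have hφd : DifferentiableAt ℝ φ (a + r • ω) := by
    have hnorm : 0 < ‖a + r • ω - a‖ := norm_pos_iff.2 (sub_ne_zero.2 hne)
    have hpow : DifferentiableAt ℝ (fun x => ‖x - a‖ ^ p) (a + r • ω) :=
      ((differentiableAt_id.sub_const a).norm ℝ (sub_ne_zero.2 hne)).rpow_const (.inl hnorm.ne')
    refine (hh.mul (hpow.inv (Real.rpow_pos_of_pos hnorm p).ne')).congr_of_eventuallyEq ?_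
    filter_upwards [isOpen_ne.mem_nhds hne] with x hx using hφ x hx
  have hline : HasDerivAt (fun t : ℝ => a + t • ω) ω r := by
    simpa using ((hasDerivAt_id r).smul_const ω).const_add a
  have h1 : HasDerivAt (fun t : ℝ => φ (a + t • ω)) _ r := hφd.hasFDerivAt.comp_hasDerivAt r hline
  have h2 : HasDerivAt (fun t : ℝ => h (a + t • ω) * t ^ (-p)) _ r :=
    (hh.hasFDerivAt.comp_hasDerivAt r hline).mul
      (Real.hasDerivAt_rpow_const (p := -p) (.inl hr.ne'))
  have hev : (fun t : ℝ => φ (a + t • ω)) =ᶠ[𝓝 r] fun t => h (a + t • ω) * t ^ (-p) := by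
    filter_upwards [lt_mem_nhds hr] with t ht
    have : ω ≠ 0 := norm_ne_zero_iff.1 (by simp [hω])
    rw [hφ _ (by simp [ht.ne', this]), Real.rpow_neg ht.le]
    simp [norm_smul, hω, abs_of_pos ht, div_eq_mul_inv]
  rw [h1.unique (h2.congr_of_eventuallyEq hev), Real.rpow_neg hr.le,
    show -p - 1 = -(p + 1) by ring, Real.rpow_neg hr.le]
  ring

theorem stmt_9 {n : ℕ} (hn : 3 ≤ n) (Ω : Set (Euc n)) (hΩ : IsOpen Ω)
    (a : Euc n) (ha : a ∈ Ω)
    (h : Euc n → ℝ) (hh : ContDiffOn ℝ 2 h Ω) (hharm : ∀ x ∈ Ω, lap h x = 0)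
    (s : ℝ) (hs : 0 ≤ s) (φ : Euc n → ℝ)
    (hφ : ∀ x : Euc n, x ≠ a → φ x = h x / ‖x - a‖ ^ ((n : ℝ) - 2 + s)) :
    ∃ ε > (0 : ℝ), ∀ r ∈ Ioo (0 : ℝ) ε,
      (sphereArea n * r ^ (n - 1))⁻¹ *
          (r ^ (n - 1) * ∫ ω : sphere (0 : Euc n) 1,
            fderiv ℝ φ (a + r • (ω : Euc n)) (ω : Euc n) ∂(unitSphereM n))
        = -((n : ℝ) - 2 + s) * h a / r ^ ((n : ℝ) - 1 + s) := by
  have hn0 : 0 < n := by omega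
  have : IsFiniteMeasure (unitSphereM n) := by unfold unitSphereM; infer_instance
  obtain ⟨R, hR, hRΩ⟩ := nhds_basis_closedBall.mem_iff.1 (hΩ.mem_nhds ha)
  have hh2 : ∀ x ∈ closedBall a R, ContDiffAt ℝ 2 h x := fun x hx =>
    hh.contDiffAt (hΩ.mem_nhds (hRΩ hx))
  have hh1 : ∀ x ∈ closedBall a R, ContDiffAt ℝ 1 h x := fun x hx =>
    (hh2 x hx).of_le (by norm_num)
  have hharm' : ∀ x ∈ closedBall a R, lap h x = 0 := fun x hx => hharm x (hRΩ hx)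
  refine ⟨R, hR, fun r hr => ?_⟩
  have hmem : ∀ ω : sphere (0 : Euc n) 1, a + r • (ω : Euc n) ∈ closedBall a R :=
    add_smul_sphere_mem_closedBall ⟨by linarith [hr.1], hr.2.le⟩
  have harea : sphereArea n ≠ 0 := by
    have : Nonempty (Fin n) := ⟨⟨0, hn0⟩⟩
    have : Nontrivial (Euc n) := inferInstance
    have : NeZero (unitSphereM n) := ⟨Measure.toSphere_ne_zero _⟩
    exact measureReal_univ_ne_zero (μ := unitSphereM n)
  have hint1 : Integrable (fun ω : sphere (0 : Euc n) 1 => h (a + r • (ω : Euc n)))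
      (unitSphereM n) := by
    refine Continuous.integrable_of_hasCompactSupport ?_ (.of_compactSpace _)
    exact ContinuousOn.comp_continuous (s := closedBall a R)
      (fun x hx => (hh1 x hx).continuousAt.continuousWithinAt) (by fun_prop) hmem
  have hint2 : Integrable (fun ω : sphere (0 : Euc n) 1 =>
      fderiv ℝ h (a + r • (ω : Euc n)) (ω : Euc n)) (unitSphereM n) := by
    refine Continuous.integrable_of_hasCompactSupport (.clm_apply ?_ continuous_subtype_val)
      (.of_compactSpace _)
    exact ContinuousOn.comp_continuous (s := closedBall a R)
      (fun x hx => ((hh1 x hx).fderiv_right (m := 0) le_rfl).continuousAt.continuousWithinAt)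
      (by fun_prop) hmem
  have hderiv : ∀ ω : sphere (0 : Euc n) 1, fderiv ℝ φ (a + r • (ω : Euc n)) (ω : Euc n) = _ :=
    fun ω => fderiv_div_norm_rpow hr.1 (norm_eq_of_mem_sphere ω)
      ((hh1 _ (hmem ω)).differentiableAt one_ne_zero) hφ
  simp_rw [hderiv]
  rw [integral_sub (hint2.const_mul _) (hint1.const_mul _), integral_const_mul,
    integral_const_mul, integral_sphere_fderiv_eq_zero hn0 hh2 hharm' hr,
    integral_sphere_eq hn0 hh2 hharm' hr, show (n : ℝ) - 2 + s + 1 = n - 1 + s by ring]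
  have := hr.1.ne'
  have := (Real.rpow_pos_of_pos hr.1 ((n : ℝ) - 1 + s)).ne'
  field_simp
  ring
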